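/- arXiv:1902.03503 — 6 statements merged into one kernel-verified Lean document; each statement's English description precedes it below -/
import Mathlib

section
/- Let s ∈ (0,1) and λ > 0, and define u : ℝ → ℝ by u(t) = (λ^s/Γ(s)) · ∫_0^∞ z^(s-1) · e^(−t²/(4z)) · e^(−λz) dz, where Γ denotes the real Gamma function. Then u(t) → 1 as t → 0 from the right. -/
open MeasureTheory in
theorem integrableOn_rpow_sub_one_mul_exp_neg_mul {s lam : ℝ} (hs : 0 < s) (hlam : 0 < lam) :
    IntegrableOn (fun z : ℝ => z ^ (s - 1) * Real.exp (-lam * z)) (Set.Ioi 0) := by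
  simpa using integrableOn_rpow_mul_exp_neg_mul_rpow (p := 1) (s := s - 1) (by linarith)
    one_pos hlam

open MeasureTheory in
/-- The heat factor `exp (-t ^ 2 / (4 * z))` disappears from the weighted Gamma integral as
`t → 0`. -/
theorem tendsto_integral_rpow_mul_exp_neg_sq_div_mul_exp {s lam : ℝ} (hs : 0 < s)
    (hlam : 0 < lam) :
    Filter.Tendsto
      (fun t : ℝ => ∫ z in Set.Ioi (0:ℝ),
        z ^ (s - 1) * Real.exp (-t ^ 2 / (4 * z)) * Real.exp (-lam * z))
      (nhds 0) (nhds (∫ z in Set.Ioi (0:ℝ), z ^ (s - 1) * Real.exp (-lam * z))) := by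
  refine tendsto_integral_filter_of_dominated_convergence
    (fun z : ℝ => z ^ (s - 1) * Real.exp (-lam * z)) ?_ ?_
    (integrableOn_rpow_sub_one_mul_exp_neg_mul hs hlam) ?_
  · exact Filter.Eventually.of_forall fun t => (by fun_prop : Measurable _).aestronglyMeasurable
  · refine Filter.Eventually.of_forall fun t =>
      (ae_restrict_iff' measurableSet_Ioi).mpr <| ae_of_all _ fun z (hz : 0 < z) => ?_
    rw [Real.norm_of_nonneg (by positivity)]
    have h : Real.exp (-t ^ 2 / (4 * z)) ≤ 1 :=
      Real.exp_le_one_iff.mpr <|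
        div_nonpos_of_nonpos_of_nonneg (neg_nonpos.mpr (sq_nonneg t)) (by positivity)
    gcongr
    exact mul_le_of_le_one_right (by positivity) h
  · refine ae_of_all _ fun z => ?_
    have h : Continuous fun t : ℝ =>
        z ^ (s - 1) * Real.exp (-t ^ 2 / (4 * z)) * Real.exp (-lam * z) := by fun_prop
    simpa using h.tendsto 0

theorem stmt_5 (s lam : ℝ) (hs : s ∈ Set.Ioo (0:ℝ) 1) (hlam : 0 < lam)
    (u : ℝ → ℝ)
    (hu : u = fun t : ℝ => (lam ^ s / Real.Gamma s) *
      ∫ z in Set.Ioi (0:ℝ), z ^ (s - 1) * Real.exp (-t ^ 2 / (4 * z)) * Real.exp (-lam * z)) :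
    Filter.Tendsto u (nhdsWithin 0 (Set.Ioi 0)) (nhds 1) := by
  have hlim := ((tendsto_integral_rpow_mul_exp_neg_sq_div_mul_exp hs.1 hlam).const_mul
    (lam ^ s / Real.Gamma s)).mono_left (nhdsWithin_le_nhds (s := Set.Ioi 0))
  have hGamma := Real.integral_rpow_mul_exp_neg_mul_Ioi hs.1 hlam
  simp only [← neg_mul] at hGamma
  have hval : lam ^ s / Real.Gamma s * ((1 / lam) ^ s * Real.Gamma s) = 1 := by
    have hG := (Real.Gamma_pos_of_pos hs.1).ne'
    have hl := (Real.rpow_pos_of_pos hlam s).ne'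
    rw [one_div, Real.inv_rpow hlam.le]
    field_simp
  rw [hGamma, hval] at hlim
  rwa [hu]
end

section
/- Let s ∈ (0,1) and λ > 0, and define u : ℝ → ℝ by u(t) = (λ^s/Γ(s)) · ∫_0^∞ z^(s-1) · e^(−t²/(4z)) · e^(−λz) dz, where Γ denotes the real Gamma function. Then t^(1−2s) · u'(t) → −c_s · λ^s as t → 0 from the right, where c_s := 2^(1−2s) · Γ(1−s)/Γ(s). -/
open MeasureTheory Set Filter Topology

lemma integrableOn_rpow_mul_exp_neg_mul {s b : ℝ} (hs : 0 < s) (hb : 0 < b) :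
    IntegrableOn (fun z : ℝ => z ^ (s - 1) * Real.exp (-b * z)) (Ioi 0) := by
  simpa using integrableOn_rpow_mul_exp_neg_mul_rpow (p := 1) (s := s - 1) (by linarith) one_pos hb

lemma integral_rpow_mul_exp_neg_div_mul_exp_neg_mul (s b : ℝ) {a : ℝ} (ha : 0 < a) :
    ∫ z in Ioi (0 : ℝ), z ^ (s - 2) * Real.exp (-a / z) * Real.exp (-b * z) =
      a ^ (s - 1) * ∫ w in Ioi (0 : ℝ), w ^ (-s) * Real.exp (-w) * Real.exp (-(b * a) / w) := by
  set g : ℝ → ℝ := fun z => z ^ (s - 2) * Real.exp (-a / z) * Real.exp (-b * z) with hg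
  have scale := integral_comp_mul_left_Ioi g 0 ha
  have invert := integral_comp_rpow_Ioi (fun x => g (a * x)) (p := -1) (by norm_num)
  rw [mul_zero, smul_eq_mul] at scale
  have main : ∫ z in Ioi (0 : ℝ), g z = a * ∫ x in Ioi (0 : ℝ), g (a * x) := by
    rw [scale, mul_inv_cancel_left₀ ha.ne']
  rw [main, ← invert, ← integral_const_mul, ← integral_const_mul]
  refine setIntegral_congr_fun measurableSet_Ioi fun x hx => ?_
  have hx : 0 < x := hx
  have hexp₁ : -a / (a * x⁻¹) = -x := by field_simp
  have hexp₂ : -b * (a * x⁻¹) = -(b * a) / x := by field_simp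
  have hpow_a : a ^ (s - 1) = a * a ^ (s - 2) := by
    nth_rw 2 [← Real.rpow_one a]
    rw [← Real.rpow_add ha]
    ring_nf
  have hpow_x : x ^ (-s) = x ^ (-1 - 1 : ℝ) * (x⁻¹) ^ (s - 2) := by
    rw [Real.inv_rpow hx.le, ← Real.rpow_neg hx.le, ← Real.rpow_add hx]
    ring_nf
  simp only [hg, smul_eq_mul, Real.rpow_neg_one, hexp₁, hexp₂, hpow_a, hpow_x, abs_neg, abs_one,
    one_mul, Real.mul_rpow ha.le (inv_nonneg.2 hx.le)]
  ring

lemma div_mul_exp_neg_sq_div_le {t z : ℝ} (ht : 0 < t) (hz : 0 < z) :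
    t / (2 * z) * Real.exp (-t ^ 2 / (4 * z)) ≤ 2 / t := by
  have h := Real.add_one_le_exp (t ^ 2 / (4 * z))
  have hle : t ^ 2 / (4 * z) ≤ Real.exp (t ^ 2 / (4 * z)) := by linarith
  rw [neg_div, Real.exp_neg, ← div_eq_mul_inv, div_le_iff₀ (Real.exp_pos _)]
  calc t / (2 * z) = 2 / t * (t ^ 2 / (4 * z)) := by field_simp; norm_num
    _ ≤ _ := by gcongr

lemma hasDerivAt_integral_rpow_mul_exp {s b t : ℝ} (hs : 0 < s) (hb : 0 < b) (ht : 0 < t) :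
    HasDerivAt (fun t : ℝ => ∫ z in Ioi (0 : ℝ),
        z ^ (s - 1) * Real.exp (-t ^ 2 / (4 * z)) * Real.exp (-b * z))
      (∫ z in Ioi (0 : ℝ), z ^ (s - 1) * (-(t / (2 * z)) * Real.exp (-t ^ 2 / (4 * z))) *
        Real.exp (-b * z)) t := by
  have hint := integrableOn_rpow_mul_exp_neg_mul hs hb
  have hmeas : ∀ x : ℝ, AEStronglyMeasurable
      (fun z : ℝ => z ^ (s - 1) * Real.exp (-x ^ 2 / (4 * z)) * Real.exp (-b * z))
      (volume.restrict (Ioi 0)) := fun x =>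
    Measurable.aestronglyMeasurable (by fun_prop)
  refine (hasDerivAt_integral_of_dominated_loc_of_deriv_le
    (bound := fun z => 4 / t * (z ^ (s - 1) * Real.exp (-b * z)))
    (F' := fun x z => z ^ (s - 1) * (-(x / (2 * z)) * Real.exp (-x ^ 2 / (4 * z))) *
        Real.exp (-b * z))
    (Ioi_mem_nhds (half_lt_self ht)) (.of_forall hmeas) ?_
    (Measurable.aestronglyMeasurable (by fun_prop)) ?_ (hint.const_mul _) ?_).2
  · refine hint.mono' (hmeas t) ?_
    filter_upwards [ae_restrict_mem measurableSet_Ioi] with z hz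
    have hz : 0 < z := hz
    have : Real.exp (-t ^ 2 / (4 * z)) ≤ 1 := by
      rw [Real.exp_le_one_iff, neg_div]
      have : 0 ≤ t ^ 2 / (4 * z) := by positivity
      linarith
    rw [Real.norm_of_nonneg (by positivity)]
    gcongr
    exact mul_le_of_le_one_right (by positivity) this
  · filter_upwards [ae_restrict_mem measurableSet_Ioi] with z hz x hx
    have hz : 0 < z := hz
    have hx : t / 2 < x := hx
    have hx₀ : 0 < x := by linarith
    have hle := div_mul_exp_neg_sq_div_le hx₀ hz
    have hle' : 2 / x ≤ 4 / t := by
      rw [div_le_div_iff₀ hx₀ ht]; linarith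
    rw [neg_mul, mul_neg, neg_mul, norm_neg, Real.norm_of_nonneg (by positivity)]
    calc _ = (x / (2 * z) * Real.exp (-x ^ 2 / (4 * z))) * (z ^ (s - 1) * Real.exp (-b * z)) := by
          ring
      _ ≤ _ := by gcongr; exact hle.trans hle'
  · filter_upwards [ae_restrict_mem measurableSet_Ioi] with z hz x _
    have hz : 0 < z := hz
    have h : HasDerivAt (fun x : ℝ => -x ^ 2 / (4 * z)) (-(x / (2 * z))) x := by
      refine (((hasDerivAt_pow 2 x).neg).div_const (4 * z)).congr_deriv ?_
      field_simp
      norm_num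
      ring
    refine ((h.exp.const_mul (z ^ (s - 1))).mul_const (Real.exp (-b * z))).congr_deriv ?_
    ring

lemma tendsto_integral_rpow_mul_exp_neg_mul_exp_neg_div {s b : ℝ} (hs : s < 1) (hb : 0 < b) :
    Tendsto (fun t : ℝ => ∫ w in Ioi (0 : ℝ),
        w ^ (-s) * Real.exp (-w) * Real.exp (-(b * (t ^ 2 / 4)) / w))
      (𝓝 0) (𝓝 (Real.Gamma (1 - s))) := by
  have hlim : Real.Gamma (1 - s) = ∫ w in Ioi (0 : ℝ), w ^ (-s) * Real.exp (-w) := by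
    rw [Real.Gamma_eq_integral (by linarith)]
    refine integral_congr_ae (.of_forall fun w => ?_)
    simp only [sub_sub_cancel_left, mul_comm]
  have hint : IntegrableOn (fun w : ℝ => w ^ (-s) * Real.exp (-w)) (Ioi 0) := by
    simpa using integrableOn_rpow_mul_exp_neg_mul (s := 1 - s) (by linarith) one_pos
  rw [hlim]
  refine tendsto_integral_filter_of_dominated_convergence _
    (.of_forall fun t => Measurable.aestronglyMeasurable (by fun_prop)) (.of_forall fun t => ?_)
    hint (.of_forall fun w => ?_)
  · filter_upwards [ae_restrict_mem measurableSet_Ioi] with w hw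
    have hw : 0 < w := hw
    rw [Real.norm_of_nonneg (by positivity)]
    refine mul_le_of_le_one_right (by positivity) ?_
    rw [Real.exp_le_one_iff, neg_div]
    have : 0 ≤ b * (t ^ 2 / 4) / w := by positivity
    linarith
  · have hc : Continuous fun t : ℝ =>
        w ^ (-s) * Real.exp (-w) * Real.exp (-(b * (t ^ 2 / 4)) / w) := by fun_prop
    simpa using hc.tendsto 0

theorem stmt_6 (s lam : ℝ) (hs : s ∈ Set.Ioo (0:ℝ) 1) (hlam : 0 < lam)
    (u : ℝ → ℝ)
    (hu : u = fun t : ℝ => (lam ^ s / Real.Gamma s) *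
      ∫ z in Set.Ioi (0:ℝ), z ^ (s - 1) * Real.exp (-t ^ 2 / (4 * z)) * Real.exp (-lam * z)) :
    Filter.Tendsto (fun t : ℝ => t ^ (1 - 2 * s) * deriv u t)
      (nhdsWithin 0 (Set.Ioi 0))
      (nhds (-(2 ^ (1 - 2 * s) * Real.Gamma (1 - s) / Real.Gamma s) * lam ^ s)) := by
  have hlim := ((tendsto_integral_rpow_mul_exp_neg_mul_exp_neg_div hs.2 hlam).mono_left
    (nhdsWithin_le_nhds (s := Ioi 0))).const_mul (-(2 ^ (1 - 2 * s) / Real.Gamma s) * lam ^ s)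
  refine (hlim.congr' ?_).trans_eq (by ring_nf)
  filter_upwards [self_mem_nhdsWithin] with t ht
  have ht : 0 < t := ht
  have hderiv : ∫ z in Ioi (0 : ℝ), z ^ (s - 1) * (-(t / (2 * z)) * Real.exp (-t ^ 2 / (4 * z))) *
      Real.exp (-lam * z) = -(t / 2) * ∫ z in Ioi (0 : ℝ),
        z ^ (s - 2) * Real.exp (-(t ^ 2 / 4) / z) * Real.exp (-lam * z) := by
    rw [← integral_const_mul]
    refine setIntegral_congr_fun measurableSet_Ioi fun z hz => ?_
    have hz : 0 < z := hz
    have hpow : z ^ (s - 1) = z * z ^ (s - 2) := by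
      nth_rw 2 [← Real.rpow_one z]
      rw [← Real.rpow_add hz]
      ring_nf
    have hexp : -(t ^ 2 / 4) / z = -t ^ 2 / (4 * z) := by field_simp
    simp only [hpow, hexp]
    field_simp
  have hpow : t ^ (1 - 2 * s) * (t / 2 * (t ^ 2 / 4) ^ (s - 1)) = 2 ^ (1 - 2 * s) := by
    have hsq : t ^ 2 / 4 = (t / 2) ^ (2 : ℝ) := by norm_num [div_pow]
    have hhalf : t / 2 * (t / 2) ^ (2 * (s - 1)) = (t / 2) ^ (-(1 - 2 * s)) := by
      nth_rw 1 [← Real.rpow_one (t / 2)]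
      rw [← Real.rpow_add (by positivity)]
      ring_nf
    rw [hsq, ← Real.rpow_mul (by positivity), hhalf, Real.rpow_neg (by positivity),
      Real.div_rpow ht.le zero_le_two]
    have := (Real.rpow_pos_of_pos ht (1 - 2 * s)).ne'
    field_simp
  rw [hu, ((hasDerivAt_integral_rpow_mul_exp hs.1 hlam ht).const_mul _).deriv, hderiv,
    integral_rpow_mul_exp_neg_div_mul_exp_neg_mul s lam (by positivity), ← hpow]
  ring
end

section
/- Let s ∈ (0,1), λ > 0, and t > 0. Then t² · ∫_0^∞ z^(−s−2) · e^(−t²/(4z)) · (1 − e^(−λz)) dz ≤ 4^s · Γ(s) · λ · t^(2−2s), where Γ denotes the real Gamma function. Consequently, the left-hand side tends to 0 as t → 0 from the right. -/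
open MeasureTheory Set in
/-- The inverse-Gamma integral. -/
lemma integral_rpow_mul_exp_neg_div_Ioi {a r : ℝ} (ha : 0 < a) (hr : 0 < r) :
    ∫ x : ℝ in Ioi 0, x ^ (-a - 1) * Real.exp (-(r / x)) = (1 / r) ^ a * Real.Gamma a := by
  rw [← Real.integral_rpow_mul_exp_neg_mul_Ioi ha hr,
    ← integral_comp_rpow_Ioi _ (neg_ne_zero.mpr one_ne_zero)]
  refine setIntegral_congr_fun measurableSet_Ioi fun x (hx : 0 < x) => ?_
  simp only [smul_eq_mul, abs_neg, abs_one, one_mul]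
  rw [← mul_assoc, ← Real.rpow_mul hx.le, ← Real.rpow_add hx, Real.rpow_neg_one, div_inv_eq_mul]
  ring_nf

open MeasureTheory Set in
lemma integrableOn_rpow_mul_exp_neg_div_Ioi {a r : ℝ} (ha : 0 < a) (hr : 0 < r) :
    IntegrableOn (fun x : ℝ => x ^ (-a - 1) * Real.exp (-(r / x))) (Ioi 0) := by
  have := Real.Gamma_pos_of_pos ha
  exact .of_integral_ne_zero (by rw [integral_rpow_mul_exp_neg_div_Ioi ha hr]; positivity)

lemma one_sub_exp_neg_mul_nonneg {lam z : ℝ} (hlam : 0 < lam) (hz : 0 < z) :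
    0 ≤ 1 - Real.exp (-lam * z) := by
  have : -lam * z ≤ 0 := by nlinarith
  linarith [Real.exp_le_one_iff.mpr this]

theorem stmt_7 (s lam : ℝ) (hs : s ∈ Set.Ioo (0:ℝ) 1) (hlam : 0 < lam) :
    (∀ t : ℝ, 0 < t →
      t ^ 2 * ∫ z in Set.Ioi (0:ℝ),
          z ^ (-s - 2) * Real.exp (-t ^ 2 / (4 * z)) * (1 - Real.exp (-lam * z)) ≤
        4 ^ s * Real.Gamma s * lam * t ^ (2 - 2 * s)) ∧
    Filter.Tendsto (fun t : ℝ => t ^ 2 * ∫ z in Set.Ioi (0:ℝ),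
        z ^ (-s - 2) * Real.exp (-t ^ 2 / (4 * z)) * (1 - Real.exp (-lam * z)))
      (nhdsWithin 0 (Set.Ioi 0)) (nhds 0) := by
  obtain ⟨hs0, hs1⟩ := hs
  have bound : ∀ t : ℝ, 0 < t →
      t ^ 2 * ∫ z in Set.Ioi (0:ℝ),
          z ^ (-s - 2) * Real.exp (-t ^ 2 / (4 * z)) * (1 - Real.exp (-lam * z)) ≤
        4 ^ s * Real.Gamma s * lam * t ^ (2 - 2 * s) := by
    intro t ht
    have hr : 0 < t ^ 2 / 4 := by positivity
    calc _ ≤ t ^ 2 * ∫ z in Set.Ioi (0:ℝ),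
          lam * (z ^ (-s - 1) * Real.exp (-(t ^ 2 / 4 / z))) := by
          gcongr ?_ * ?_
          refine MeasureTheory.integral_mono_of_nonneg ?_
            ((integrableOn_rpow_mul_exp_neg_div_Ioi hs0 hr).const_mul lam) ?_
          · filter_upwards [MeasureTheory.ae_restrict_mem measurableSet_Ioi] with z hz
            have hz : 0 < z := hz
            have := one_sub_exp_neg_mul_nonneg hlam hz
            simp only [Pi.zero_apply]
            positivity
          · filter_upwards [MeasureTheory.ae_restrict_mem measurableSet_Ioi] with z hz
            have hz : 0 < z := hz
            have hle : 1 - Real.exp (-lam * z) ≤ lam * z := by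
              linarith [Real.add_one_le_exp (-lam * z)]
            have hpow : z ^ (-s - 1) = z ^ (-s - 2) * z := by
              rw [← Real.rpow_add_one hz.ne']
              ring_nf
            rw [show -(t ^ 2 / 4 / z) = -t ^ 2 / (4 * z) by field_simp, hpow]
            calc _ ≤ z ^ (-s - 2) * Real.exp (-t ^ 2 / (4 * z)) * (lam * z) := by gcongr
              _ = _ := by ring
      _ = _ := by
          rw [MeasureTheory.integral_const_mul, integral_rpow_mul_exp_neg_div_Ioi hs0 hr,
            one_div_div, Real.div_rpow (by norm_num) (by positivity), Real.rpow_sub ht,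
            Real.rpow_mul ht.le, Real.rpow_two]
          ring
  refine ⟨bound, ?_⟩
  have lim : Filter.Tendsto (fun t : ℝ => 4 ^ s * Real.Gamma s * lam * t ^ (2 - 2 * s))
      (nhdsWithin 0 (Set.Ioi 0)) (nhds 0) := by
    have hp : 0 < 2 - 2 * s := by linarith
    have := ((Real.continuous_rpow_const hp.le).tendsto 0).const_mul (4 ^ s * Real.Gamma s * lam)
    rw [Real.zero_rpow hp.ne', mul_zero] at this
    exact this.mono_left nhdsWithin_le_nhds
  refine squeeze_zero' (Filter.Eventually.of_forall fun t => ?_)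
    (by filter_upwards [self_mem_nhdsWithin] with t ht using bound t ht) lim
  refine mul_nonneg (sq_nonneg t)
    (MeasureTheory.setIntegral_nonneg measurableSet_Ioi fun z (hz : 0 < z) => ?_)
  have := one_sub_exp_neg_mul_nonneg hlam hz
  positivity
end

section
/- Let s ∈ (0,1) and λ > 0. Then ∫_0^∞ z^(−s−1) · (e^(−λz) − 1) dz = Γ(−s) · λ^s, where Γ denotes the real Gamma function (which is negative at −s for s ∈ (0,1)). -/
open Set Filter Topology MeasureTheory

lemma abs_exp_neg_mul_sub_one_le {lam z : ℝ} (hlam : 0 ≤ lam) (hz : 0 ≤ z) :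
    |Real.exp (-lam * z) - 1| ≤ lam * z := by
  have h := Real.add_one_le_exp (-lam * z)
  have h' : Real.exp (-lam * z) ≤ 1 := Real.exp_le_one_iff.2 (by nlinarith [mul_nonneg hlam hz])
  rw [abs_of_nonpos (by linarith)]
  linarith

lemma abs_exp_neg_mul_sub_one_le_one {lam z : ℝ} (hlam : 0 ≤ lam) (hz : 0 ≤ z) :
    |Real.exp (-lam * z) - 1| ≤ 1 := by
  have h := Real.exp_pos (-lam * z)
  have h' : Real.exp (-lam * z) ≤ 1 := Real.exp_le_one_iff.2 (by nlinarith [mul_nonneg hlam hz])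
  rw [abs_of_nonpos (by linarith)]
  linarith

lemma rpow_mul_exp_sub_one_integrableOn {s lam : ℝ} (hs : s ∈ Ioo (0 : ℝ) 1) (hlam : 0 ≤ lam) :
    IntegrableOn (fun z : ℝ ↦ (Real.exp (-lam * z) - 1) * z ^ (-s - 1)) (Ioi 0) := by
  have hmeas : Measurable (fun z : ℝ ↦ (Real.exp (-lam * z) - 1) * z ^ (-s - 1)) := by fun_prop
  rw [← Ioc_union_Ioi_eq_Ioi zero_le_one, integrableOn_union]
  constructor
  · have h : IntegrableOn (fun z : ℝ ↦ z ^ (-s)) (Ioc 0 1) := by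
      rw [integrableOn_Ioc_iff_integrableOn_Ioo,
        intervalIntegral.integrableOn_Ioo_rpow_iff zero_lt_one]
      linarith [hs.2]
    refine (h.const_mul lam).mono' hmeas.aestronglyMeasurable
      (ae_restrict_of_forall_mem measurableSet_Ioc fun z hz ↦ ?_)
    have hz0 : 0 < z := hz.1
    have hp : z ^ (-s) = z * z ^ (-s - 1) := by
      rw [Real.rpow_sub_one hz0.ne']; field_simp
    rw [norm_mul, Real.norm_eq_abs, Real.norm_of_nonneg (by positivity), hp, ← mul_assoc]
    gcongr
    exact abs_exp_neg_mul_sub_one_le hlam hz0.le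
  · have h : IntegrableOn (fun z : ℝ ↦ z ^ (-s - 1)) (Ioi 1) :=
      integrableOn_Ioi_rpow_of_lt (by linarith [hs.1]) zero_lt_one
    refine h.mono' hmeas.aestronglyMeasurable
      (ae_restrict_of_forall_mem measurableSet_Ioi fun z hz ↦ ?_)
    have hz0 : 0 < z := zero_lt_one.trans hz
    rw [norm_mul, Real.norm_eq_abs, Real.norm_of_nonneg (by positivity)]
    exact mul_le_of_le_one_left (by positivity) (abs_exp_neg_mul_sub_one_le_one hlam hz0.le)

lemma tendsto_exp_sub_one_mul_rpow_nhdsGT_zero {s lam : ℝ} (hs : s < 1) (hlam : 0 ≤ lam) :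
    Tendsto (fun z : ℝ ↦ (Real.exp (-lam * z) - 1) * z ^ (-s)) (𝓝[>] 0) (𝓝 0) := by
  have h : Tendsto (fun z : ℝ ↦ lam * z ^ (1 - s)) (𝓝[>] 0) (𝓝 0) := by
    have hc : ContinuousAt (fun z : ℝ ↦ lam * z ^ (1 - s)) 0 :=
      (Real.continuousAt_rpow_const 0 (1 - s) (Or.inr (by linarith))).const_mul lam
    have := hc.tendsto
    rw [Real.zero_rpow (by linarith), mul_zero] at this
    exact this.mono_left nhdsWithin_le_nhds
  refine squeeze_zero_norm' ?_ h
  filter_upwards [self_mem_nhdsWithin] with z (hz : 0 < z)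
  rw [norm_mul, Real.norm_eq_abs, Real.norm_of_nonneg (by positivity), sub_eq_add_neg 1 s,
    Real.rpow_add hz, Real.rpow_one, ← mul_assoc]
  gcongr
  exact abs_exp_neg_mul_sub_one_le hlam hz.le

lemma tendsto_exp_sub_one_mul_rpow_atTop {s lam : ℝ} (hs : 0 < s) (hlam : 0 ≤ lam) :
    Tendsto (fun z : ℝ ↦ (Real.exp (-lam * z) - 1) * z ^ (-s)) atTop (𝓝 0) := by
  refine squeeze_zero_norm' ?_ (tendsto_rpow_neg_atTop hs)
  filter_upwards [eventually_gt_atTop 0] with z hz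
  rw [norm_mul, Real.norm_eq_abs, Real.norm_of_nonneg (by positivity)]
  exact mul_le_of_le_one_left (by positivity) (abs_exp_neg_mul_sub_one_le_one hlam hz.le)

theorem stmt_8 (s lam : ℝ) (hs : s ∈ Set.Ioo (0:ℝ) 1) (hlam : 0 < lam) :
    ∫ z in Set.Ioi (0:ℝ), z ^ (-s - 1) * (Real.exp (-lam * z) - 1) =
      Real.Gamma (-s) * lam ^ s := by
  have hs0 : s ≠ 0 := hs.1.ne'
  have hu (z : ℝ) : HasDerivAt (fun z ↦ Real.exp (-lam * z) - 1)
      (-lam * Real.exp (-lam * z)) z := by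
    have := (((hasDerivAt_id z).const_mul (-lam)).exp).sub_const 1
    simpa [mul_comm] using this
  have hv (z : ℝ) (hz : z ∈ Ioi (0 : ℝ)) : HasDerivAt (fun z : ℝ ↦ z ^ (-s) * (-s)⁻¹)
      (z ^ (-s - 1)) z := by
    refine ((Real.hasDerivAt_rpow_const (p := -s) (Or.inl (ne_of_gt hz))).mul_const
      (-s)⁻¹).congr_deriv ?_
    field_simp
  have hint : IntegrableOn (fun z : ℝ ↦ z ^ (-s) * Real.exp (-lam * z)) (Ioi 0) := by
    simpa using integrableOn_rpow_mul_exp_neg_mul_rpow (p := 1) (s := -s) (b := lam)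
      (by linarith [hs.2]) one_pos hlam
  have hu'v (z : ℝ) : -lam * Real.exp (-lam * z) * (z ^ (-s) * (-s)⁻¹) =
      lam / s * (z ^ (-s) * Real.exp (-lam * z)) := by
    field_simp
  have hparts := integral_Ioi_mul_deriv_eq_deriv_mul (fun z _ ↦ hu z) hv
    (rpow_mul_exp_sub_one_integrableOn hs hlam.le)
    (by simp_rw [Pi.mul_def, hu'v]; exact hint.const_mul _)
    (a' := 0) (b' := 0)
    (by simpa [Pi.mul_def, mul_assoc] using
      (tendsto_exp_sub_one_mul_rpow_nhdsGT_zero hs.2 hlam.le).mul_const (-s)⁻¹)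
    (by simpa [Pi.mul_def, mul_assoc] using
      (tendsto_exp_sub_one_mul_rpow_atTop hs.1 hlam.le).mul_const (-s)⁻¹)
  have hgamma : ∫ z in Ioi (0 : ℝ), z ^ (-s) * Real.exp (-lam * z) =
      (1 / lam) ^ (1 - s) * Real.Gamma (1 - s) := by
    simpa using Real.integral_rpow_mul_exp_neg_mul_Ioi (a := 1 - s) (by linarith [hs.2]) hlam
  have hrec : Real.Gamma (1 - s) = -s * Real.Gamma (-s) := by
    rw [← Real.Gamma_add_one (neg_ne_zero.2 hs0), neg_add_eq_sub]
  have hpow : (1 / lam) ^ (1 - s) = lam ^ s / lam := by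
    rw [one_div, Real.inv_rpow hlam.le, ← Real.rpow_neg hlam.le, neg_sub,
      Real.rpow_sub_one hlam.ne']
  simp_rw [mul_comm (_ ^ (-s - 1))]
  rw [hparts]
  simp_rw [hu'v]
  rw [integral_const_mul, hgamma, hrec, hpow]
  field_simp
  ring
end

section
/- Let h > 0 and let a ∈ ℝ with h·a ≠ 2. Then e^(ha) − (2 + ha)/(2 − ha) = (h³a³/(2 − ha)) · ∫_0^1 w·(w−1)·e^(ha(1−w)) dw. -/
theorem pow_three_mul_integral_mul_exp (x : ℝ) :
    x ^ 3 * ∫ w in (0:ℝ)..1, w * (w - 1) * Real.exp (x * (1 - w)) =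
      (2 - x) * Real.exp x - (2 + x) := by
  have hderiv (w : ℝ) : HasDerivAt
      (fun w => -(x ^ 2 * (w * (w - 1)) + x * (2 * w - 1) + 2) * Real.exp (x * (1 - w)))
      (x ^ 3 * (w * (w - 1) * Real.exp (x * (1 - w)))) w := by
    have hid := hasDerivAt_id' w
    have hpoly := ((((hid.mul (hid.sub_const 1)).const_mul (x ^ 2)).add
      (((hid.const_mul 2).sub_const 1).const_mul x)).add_const 2).neg
    have hexp := ((hid.const_sub 1).const_mul x).exp
    refine (hpoly.mul hexp).congr_deriv ?_
    simp only [Pi.neg_apply, Pi.add_apply, Pi.mul_apply]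
    ring
  rw [← intervalIntegral.integral_const_mul,
    intervalIntegral.integral_eq_sub_of_hasDerivAt (fun w _ => hderiv w)
      (Continuous.intervalIntegrable (by fun_prop) _ _)]
  norm_num
  ring

theorem stmt_16 (h a : ℝ) (hh : 0 < h) (hha : h * a ≠ 2) :
    Real.exp (h * a) - (2 + h * a) / (2 - h * a) =
      (h ^ 3 * a ^ 3 / (2 - h * a)) *
        ∫ w in (0:ℝ)..1, w * (w - 1) * Real.exp (h * a * (1 - w)) := by
  have hne : 2 - h * a ≠ 0 := sub_ne_zero.mpr hha.symm
  rw [div_mul_eq_mul_div, ← mul_pow, pow_three_mul_integral_mul_exp, sub_div,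
    mul_div_cancel_left₀ _ hne]
end

section
/- Let h > 0 and let a ≤ 0. Then |e^(ha) − (2 + ha)/(2 − ha)| ≤ h³·(−a)³/12. -/
theorem nonneg_of_hasDerivAt_nonneg {f f' : ℝ → ℝ} (hf : ∀ x, HasDerivAt f (f' x) x)
    (h0 : f 0 = 0) (hf' : ∀ x, 0 ≤ x → 0 ≤ f' x) {x : ℝ} (hx : 0 ≤ x) : 0 ≤ f x := by
  have hmono : MonotoneOn f (Set.Ici 0) := by
    refine monotoneOn_of_deriv_nonneg (convex_Ici 0)
      (fun y _ => (hf y).continuousAt.continuousWithinAt)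
      (fun y _ => (hf y).differentiableAt.differentiableWithinAt) fun y hy => ?_
    rw [(hf y).deriv]
    exact hf' y (interior_subset hy)
  simpa [h0] using hmono Set.self_mem_Ici hx hx

theorem hasDerivAt_const_add_mul_exp_neg (c x : ℝ) :
    HasDerivAt (fun x => (c + x) * Real.exp (-x)) ((1 - c - x) * Real.exp (-x)) x := by
  refine (((hasDerivAt_id x).const_add c).mul (hasDerivAt_neg x).exp).congr_deriv ?_
  simp only [id]
  ring

theorem one_add_mul_exp_neg_le_one (x : ℝ) : (1 + x) * Real.exp (-x) ≤ 1 := by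
  calc (1 + x) * Real.exp (-x) ≤ Real.exp x * Real.exp (-x) := by
        gcongr
        linarith [Real.add_one_le_exp x]
    _ = 1 := by rw [← Real.exp_add, add_neg_cancel, Real.exp_zero]

theorem one_sub_sq_div_two_le_one_add_mul_exp_neg {x : ℝ} (hx : 0 ≤ x) :
    1 - x ^ 2 / 2 ≤ (1 + x) * Real.exp (-x) := by
  have key := nonneg_of_hasDerivAt_nonneg
    (f := fun x => (1 + x) * Real.exp (-x) + (x ^ 2 / 2 - 1))
    (fun y => (hasDerivAt_const_add_mul_exp_neg 1 y).add
      (((hasDerivAt_pow 2 y).div_const 2).sub_const 1)) (by simp) (fun y hy => ?_) hx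
  · linarith
  · have : Real.exp (-y) ≤ 1 := Real.exp_le_one_iff.2 (by linarith)
    norm_num
    nlinarith

theorem two_sub_le_two_add_mul_exp_neg {x : ℝ} (hx : 0 ≤ x) :
    2 - x ≤ (2 + x) * Real.exp (-x) := by
  have key := nonneg_of_hasDerivAt_nonneg
    (f := fun x => (2 + x) * Real.exp (-x) + (x - 2))
    (fun y => (hasDerivAt_const_add_mul_exp_neg 2 y).add ((hasDerivAt_id y).sub_const 2))
    (by simp) (fun y _ => ?_) hx
  · linarith
  · linarith [one_add_mul_exp_neg_le_one y]

theorem two_add_mul_exp_neg_le {x : ℝ} (hx : 0 ≤ x) :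
    (2 + x) * Real.exp (-x) ≤ 2 - x + x ^ 3 / 6 := by
  have key := nonneg_of_hasDerivAt_nonneg
    (f := fun x => (x ^ 3 / 6 + (2 - x)) - (2 + x) * Real.exp (-x))
    (fun y => (((hasDerivAt_pow 3 y).div_const 6).add ((hasDerivAt_id y).const_sub 2)).sub
      (hasDerivAt_const_add_mul_exp_neg 2 y))
    (by simp) (fun y hy => ?_) hx
  · linarith
  · norm_num
    linarith [one_sub_sq_div_two_le_one_add_mul_exp_neg hy]

theorem abs_exp_neg_sub_div_le {x : ℝ} (hx : 0 ≤ x) :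
    |Real.exp (-x) - (2 - x) / (2 + x)| ≤ x ^ 3 / 12 := by
  have hpos : 0 < 2 + x := by linarith
  have hdiff : Real.exp (-x) - (2 - x) / (2 + x) =
      ((2 + x) * Real.exp (-x) - (2 - x)) / (2 + x) := by
    field_simp
  have hlower := two_sub_le_two_add_mul_exp_neg hx
  have hupper := two_add_mul_exp_neg_le hx
  rw [hdiff, abs_of_nonneg (div_nonneg (by linarith) hpos.le), div_le_iff₀ hpos]
  nlinarith [pow_nonneg hx 4]

theorem stmt_17 (h a : ℝ) (hh : 0 < h) (ha : a ≤ 0) :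
    |Real.exp (h * a) - (2 + h * a) / (2 - h * a)| ≤ h ^ 3 * (-a) ^ 3 / 12 := by
  have key := abs_exp_neg_sub_div_le (mul_nonneg hh.le (neg_nonneg.2 ha))
  simpa only [mul_neg, neg_neg, sub_neg_eq_add, ← sub_eq_add_neg, ← mul_pow] using key
end
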